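/- arXiv:2103.11046 — 8 statements merged into one kernel-verified Lean document; each statement's English description precedes it below -/
import Mathlib

section
/- Let F be a finite field, let k, v, r be positive integers with 0 < r ≤ v and v − r ≤ 1 (i.e., v = r or v = r + 1), and let A ∈ F^{k×v} be a generalized Cauchy matrix. Then the extended Cauchy code C(A,k,v,r) ⊆ F^{k+r} is a generalized Reed–Solomon code. -/
open Polynomial

/-- The extended Cauchy (EC) code `C(A,k,v,r)`: the right kernel of the
parity-check matrix `H = [A; -I_r 0]ᵀ`, viewed as a set of vectors of length `k + r`. -/
def ECCode {F : Type} [Field F] {k v : ℕ} (A : Matrix (Fin k) (Fin v) F) (r : ℕ)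
    (hrv : r ≤ v) : Set (Fin (k + r) → F) :=
  {x | (∀ j : Fin r,
          ∑ i : Fin k, x (Fin.castAdd r i) * A i (Fin.castLE hrv j) = x (Fin.natAdd k j)) ∧
       ∀ j : Fin v, r ≤ (j : ℕ) → ∑ i : Fin k, x (Fin.castAdd r i) * A i j = 0}

/-- A linear code `C ⊆ Fⁿ` is a generalized Reed–Solomon (GRS) code if there are an
integer `k' ≥ 0`, pairwise distinct evaluation points `α`, and nonzero multipliers `μ`
with `C = {(μ i * f(α i))_i : f ∈ F[X], deg f < k'}`. -/
def IsGRS {F : Type} [Field F] {n : ℕ} (Code : Set (Fin n → F)) : Prop :=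
  ∃ (k' : ℕ) (α μ : Fin n → F),
    Function.Injective α ∧ (∀ i, μ i ≠ 0) ∧
    Code = {x | ∃ f : Polynomial F, f.degree < (k' : WithBot ℕ) ∧ ∀ i, x i = μ i * f.eval (α i)}

/-- The barycentric form of Lagrange interpolation, read as a Cauchy-type sum. -/
theorem sum_nodalWeight_mul_eval_div {F : Type} [Field F] {k : ℕ} {a : Fin k → F}
    (ha : Function.Injective a) {f : F[X]} (hf : f.degree < (k : WithBot ℕ)) {t : F}
    (ht : ∀ i, a i ≠ t) :
    ∑ i, Lagrange.nodalWeight Finset.univ a i * f.eval (a i) / (a i - t) =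
      -(f.eval t) / (Lagrange.nodal Finset.univ a).eval t := by
  have hnode : (Lagrange.nodal Finset.univ a).eval t ≠ 0 :=
    Lagrange.eval_nodal_not_at_node fun i _ => (ht i).symm
  have hfi : f = Lagrange.interpolate Finset.univ a fun i => f.eval (a i) :=
    Lagrange.eq_interpolate ha.injOn (by simpa using hf)
  have h := Lagrange.eval_interpolate_not_at_node (s := Finset.univ) (v := a)
    (fun i => f.eval (a i)) (x := t) fun i _ => (ht i).symm
  rw [← hfi] at h
  rw [eq_div_iff hnode, h, mul_comm, ← mul_neg, ← Finset.sum_neg_distrib]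
  congr 1
  refine Finset.sum_congr rfl fun i _ => ?_
  have h1 : a i - t ≠ 0 := sub_ne_zero.mpr (ht i)
  have h2 : t - a i ≠ 0 := sub_ne_zero.mpr (ht i).symm
  field_simp
  ring

/-- The column multipliers exhibiting an extended Cauchy code as an evaluation code. -/
noncomputable def ecMultiplier {F : Type} [Field F] {k v : ℕ} (a : Fin k → F) (b : Fin v → F)
    (c : Fin k → F) (d : Fin v → F) {r : ℕ} (hrv : r ≤ v) : Fin (k + r) → F :=
  Fin.append (fun i => Lagrange.nodalWeight Finset.univ a i / c i)
    (fun j => -d (Fin.castLE hrv j) /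
      (Lagrange.nodal Finset.univ a).eval (b (Fin.castLE hrv j)))

/-- An extended Cauchy code consists of the scaled evaluations of the polynomials of degree
less than `k` that vanish at the points of the unused columns. -/
theorem mem_ECCode_iff {F : Type} [Field F] {k v r : ℕ} (hrv : r ≤ v)
    {a : Fin k → F} {b : Fin v → F} {c : Fin k → F} {d : Fin v → F}
    (ha : Function.Injective a) (hab : ∀ i j, a i ≠ b j)
    (hc : ∀ i, c i ≠ 0) (hd : ∀ j, d j ≠ 0) {A : Matrix (Fin k) (Fin v) F}
    (hA : ∀ i j, A i j = c i * d j / (a i - b j)) (x : Fin (k + r) → F) :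
    x ∈ ECCode A r hrv ↔ ∃ f : F[X], f.degree < (k : WithBot ℕ) ∧
      (∀ i, x i = ecMultiplier a b c d hrv i *
        f.eval (Fin.append a (fun j => b (Fin.castLE hrv j)) i)) ∧
      ∀ j : Fin v, r ≤ (j : ℕ) → f.eval (b j) = 0 := by
  have hw : ∀ i, Lagrange.nodalWeight Finset.univ a i ≠ 0 := fun i =>
    Lagrange.nodalWeight_ne_zero ha.injOn (Finset.mem_univ i)
  have hnode : ∀ j, (Lagrange.nodal Finset.univ a).eval (b j) ≠ 0 := fun j =>
    Lagrange.eval_nodal_not_at_node fun i _ => (hab i j).symm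
  have key : ∀ f : F[X], f.degree < (k : WithBot ℕ) →
      (∀ i, x (Fin.castAdd r i) = Lagrange.nodalWeight Finset.univ a i / c i * f.eval (a i)) →
      ∀ j, ∑ i, x (Fin.castAdd r i) * A i j =
        -d j / (Lagrange.nodal Finset.univ a).eval (b j) * f.eval (b j) := by
    intro f hf hx j
    have h := sum_nodalWeight_mul_eval_div ha hf fun i => hab i j
    calc ∑ i, x (Fin.castAdd r i) * A i j
        = d j * ∑ i, Lagrange.nodalWeight Finset.univ a i * f.eval (a i) / (a i - b j) := by
          rw [Finset.mul_sum]
          refine Finset.sum_congr rfl fun i _ => ?_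
          rw [hx, hA]
          have := hc i
          field_simp
      _ = _ := by rw [h]; ring
  constructor
  · rintro ⟨h1, h2⟩
    set y : Fin k → F := fun i =>
      x (Fin.castAdd r i) * c i / Lagrange.nodalWeight Finset.univ a i with hy
    have hdeg : (Lagrange.interpolate Finset.univ a y).degree < (k : WithBot ℕ) := by
      simpa using Lagrange.degree_interpolate_lt y (s := Finset.univ) (v := a) ha.injOn
    have hx : ∀ i, x (Fin.castAdd r i) = Lagrange.nodalWeight Finset.univ a i / c i *
        (Lagrange.interpolate Finset.univ a y).eval (a i) := by
      intro i
      rw [Lagrange.eval_interpolate_at_node y ha.injOn (Finset.mem_univ i), hy]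
      have := hc i
      have := hw i
      field_simp
    refine ⟨_, hdeg, fun i => ?_, fun j hj => ?_⟩
    · induction i using Fin.addCases with
      | left i => simpa [ecMultiplier] using hx i
      | right j => simpa [ecMultiplier] using (h1 j).symm.trans (key _ hdeg hx _)
    · have h := (key _ hdeg hx j).symm.trans (h2 j hj)
      exact (mul_eq_zero.mp h).resolve_left (div_ne_zero (neg_ne_zero.mpr (hd j)) (hnode j))
  · rintro ⟨f, hf, hx, hv⟩
    have hkey := key f hf fun i => by simpa [ecMultiplier] using hx (Fin.castAdd r i)
    refine ⟨fun j => ?_, fun j hj => ?_⟩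
    · rw [hkey, hx (Fin.natAdd k j)]
      simp [ecMultiplier]
    · rw [hkey, hv j hj, mul_zero]

/-- an EC code with `v − r ≤ 1` (i.e. `v = r` or `v = r + 1`)
is a generalized Reed–Solomon code. -/
theorem ec_code_is_GRS_of_small_corank {F : Type} [Field F] [Fintype F]
    (k v r : ℕ) (hk : 0 < k) (hr : 0 < r) (hrv : r ≤ v) (hvr : v - r ≤ 1)
    (a : Fin k → F) (b : Fin v → F) (c : Fin k → F) (d : Fin v → F)
    (hdist : Function.Injective (Sum.elim a b))
    (hc : ∀ i, c i ≠ 0) (hd : ∀ j, d j ≠ 0)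
    (A : Matrix (Fin k) (Fin v) F)
    (hA : ∀ i j, A i j = c i * d j / (a i - b j)) :
    IsGRS (ECCode A r hrv) := by
  obtain ⟨ha, hb, hab⟩ := Sum.elim_injective.mp hdist
  have hmem := mem_ECCode_iff hrv ha hab hc hd hA
  have hα : Function.Injective (Fin.append a (fun j => b (Fin.castLE hrv j))) :=
    Fin.append_injective_iff.mpr
      ⟨ha, hb.comp (Fin.castLE_injective hrv), fun i j => hab i _⟩
  have hμ : ∀ i, ecMultiplier a b c d hrv i ≠ 0 := by
    intro i
    induction i using Fin.addCases with
    | left i =>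
      simpa [ecMultiplier, hc i] using
        Lagrange.nodalWeight_ne_zero ha.injOn (Finset.mem_univ i)
    | right j =>
      simpa [ecMultiplier, hd] using
        Lagrange.eval_nodal_not_at_node fun i _ => (hab i (Fin.castLE hrv j)).symm
  obtain rfl | rfl : v = r ∨ v = r + 1 := by omega
  · refine ⟨k, _, _, hα, hμ, Set.ext fun x => (hmem x).trans ?_⟩
    refine exists_congr fun f => and_congr_right fun _ => and_iff_left fun j hj => ?_
    exact absurd j.isLt hj.not_gt
  · set α := Fin.append a (fun j => b (Fin.castLE hrv j)) with hαdef
    have hβ : ∀ i, α i - b (Fin.last r) ≠ 0 := by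
      intro i
      rw [sub_ne_zero]
      induction i using Fin.addCases with
      | left i => simpa [hαdef] using hab i _
      | right j =>
        have hj : Fin.castLE hrv j ≠ Fin.last r := (Fin.castSucc_lt_last j).ne
        simpa [hαdef] using hb.ne hj
    refine ⟨k - 1, α, fun i => ecMultiplier a b c d hrv i * (α i - b (Fin.last r)), hα,
      fun i => mul_ne_zero (hμ i) (hβ i), Set.ext fun x => (hmem x).trans ?_⟩
    have hdeg : ∀ g : F[X], ((X - C (b (Fin.last r))) * g).degree < (k : WithBot ℕ) ↔
        g.degree < ((k - 1 : ℕ) : WithBot ℕ) := by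
      intro g
      obtain ⟨m, rfl⟩ : ∃ m, k = m + 1 := ⟨k - 1, by omega⟩
      rcases eq_or_ne g 0 with rfl | hg
      · simp
      · rw [degree_mul, degree_X_sub_C, degree_eq_natDegree hg]
        norm_cast
        omega
    constructor
    · rintro ⟨f, hf, hx, hv⟩
      obtain ⟨g, rfl⟩ := dvd_iff_isRoot.mpr (hv (Fin.last r) le_rfl)
      refine ⟨g, (hdeg g).mp hf, fun i => ?_⟩
      rw [hx i, eval_mul, eval_sub, eval_X, eval_C, mul_assoc]
    · rintro ⟨g, hg, hx⟩
      refine ⟨(X - C (b (Fin.last r))) * g, (hdeg g).mpr hg, fun i => ?_, fun j hj => ?_⟩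
      · rw [hx i, eval_mul, eval_sub, eval_X, eval_C, mul_assoc]
      · obtain rfl : j = Fin.last r := Fin.ext (by have := j.isLt; simp; omega)
        simp
end

section
/- Let F be a finite field, let k, v, r be positive integers with v − k < r ≤ v, and let A ∈ F^{k×v} be a generalized Cauchy matrix. Then the extended Cauchy code C(A,k,v,r) ⊆ F^{k+r} is an F-linear subspace of dimension k + r − v, and every nonzero codeword x ∈ C(A,k,v,r) has Hamming weight at least v + 1; that is, C(A,k,v,r) is an MDS code of length k+r, dimension k+r−v, and minimum distance v+1. -/
open Polynomial in
/-- A linear combination of `s` partial fractions `1 / (a i - z)` with distinct poles which vanishes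
at `s` or more points has all its coefficients equal to zero. -/
lemma eq_zero_of_sum_div_sub_eq_zero {F ι : Type*} [Field F] [DecidableEq ι]
    (S : Finset ι) (T : Finset F) (a y : ι → F) (ha : Set.InjOn a S)
    (haT : ∀ i ∈ S, ∀ z ∈ T, a i ≠ z) (hST : S.card ≤ T.card)
    (hy : ∀ z ∈ T, ∑ i ∈ S, y i / (a i - z) = 0) : ∀ i ∈ S, y i = 0 := by
  intro i hi
  set g : F[X] := ∑ i ∈ S, C (y i) * ∏ l ∈ S.erase i, (C (a l) - X) with hg
  have hdeg : g.degree < T.card := by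
    rw [hg]
    refine (degree_sum_le _ _).trans_lt ?_
    rw [Finset.sup_lt_iff (WithBot.bot_lt_coe _)]
    intro j hj
    calc (C (y j) * ∏ l ∈ S.erase j, (C (a l) - X)).degree
        ≤ 0 + ∑ l ∈ S.erase j, (1 : WithBot ℕ) := by
          refine (degree_mul_le _ _).trans (add_le_add degree_C_le ?_)
          refine (degree_prod_le _ _).trans (Finset.sum_le_sum fun l _ => ?_)
          refine (degree_sub_le _ _).trans (max_le (degree_C_le.trans ?_) degree_X_le)
          exact zero_le_one
      _ < T.card := by
          have hpos := Finset.card_pos.2 ⟨j, hj⟩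
          rw [Finset.sum_const, Finset.card_erase_of_mem hj, zero_add, nsmul_one]
          exact_mod_cast (by omega : S.card - 1 < T.card)
  have heval : ∀ z ∈ T, g.eval z = 0 := by
    intro z hz
    have hprod : g.eval z = (∏ l ∈ S, (a l - z)) * ∑ i ∈ S, y i / (a i - z) := by
      rw [hg, eval_finsetSum, Finset.mul_sum]
      refine Finset.sum_congr rfl fun j hj => ?_
      have hne : a j - z ≠ 0 := sub_ne_zero.2 (haT j hj z hz)
      rw [← Finset.mul_prod_erase S _ hj]
      simp only [eval_mul, eval_C, eval_prod, eval_sub, eval_X]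
      field_simp
    rw [hprod, hy z hz, mul_zero]
  have hzero : g = 0 := eq_zero_of_degree_lt_of_eval_finset_eq_zero T hdeg heval
  have hai : g.eval (a i) = y i * ∏ l ∈ S.erase i, (a l - a i) := by
    rw [hg, eval_finsetSum, Finset.sum_eq_single_of_mem i hi]
    · simp [eval_prod]
    · intro j _ hji
      rw [eval_mul, eval_prod, Finset.prod_eq_zero (Finset.mem_erase.2 ⟨hji.symm, hi⟩), mul_zero]
      simp
  rw [hzero, eval_zero] at hai
  refine (mul_eq_zero.1 hai.symm).resolve_right (Finset.prod_ne_zero_iff.2 fun l hl => ?_)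
  rw [Finset.mem_erase] at hl
  exact sub_ne_zero.2 fun h => hl.1 (ha hl.2 hi h)

/-- The Hamming norm of a vector is the sum of the Hamming norms of its two blocks. -/
lemma hammingNorm_fin_add {F : Type*} [Zero F] [DecidableEq F] {k r : ℕ} (x : Fin (k + r) → F) :
    hammingNorm x = hammingNorm (fun i => x (Fin.castAdd r i)) +
      hammingNorm (fun j => x (Fin.natAdd k j)) := by
  simp only [hammingNorm, Finset.card_filter, Fin.sum_univ_add]

/-- A subspace of `F^n` whose nonzero vectors have Hamming norm greater than `v` has dimension at
most `n - v`. -/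
lemma finrank_le_of_lt_hammingNorm {F : Type*} [Field F] [DecidableEq F] {n v : ℕ} (hv : v ≤ n)
    (W : Submodule F (Fin n → F)) (hW : ∀ x ∈ W, x ≠ 0 → v < hammingNorm x) :
    Module.finrank F W ≤ n - v := by
  let f : W →ₗ[F] (Fin (n - v) → F) :=
    LinearMap.funLeft F F (Fin.castLE (Nat.sub_le n v)) ∘ₗ W.subtype
  have hf : Function.Injective f := by
    rw [← LinearMap.ker_eq_bot, LinearMap.ker_eq_bot']
    rintro ⟨x, hx⟩ hfx
    by_contra hne
    have hlt := hW x hx fun h => hne (Subtype.ext h)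
    have hvanish : ∀ i : Fin n, (i : ℕ) < n - v → x i = 0 := fun i hi => congrFun hfx ⟨i, hi⟩
    have hinj : hammingNorm x ≤ (Finset.Ico (n - v) n).card := by
      refine Finset.card_le_card_of_injOn Fin.val (fun i hi => ?_) Fin.val_injective.injOn
      have hxi : x i ≠ 0 := by simpa using hi
      have hge : n - v ≤ (i : ℕ) := not_lt.1 fun h => hxi (hvanish i h)
      simp [hge]
    rw [Nat.card_Ico] at hinj
    omega
  simpa using LinearMap.finrank_le_finrank_of_injective hf

/-- The syndrome map of the extended Cauchy code. -/
def ecSyndrome {F : Type} [Field F] {k v : ℕ} (A : Matrix (Fin k) (Fin v) F) (r : ℕ) :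
    (Fin (k + r) → F) →ₗ[F] (Fin v → F) where
  toFun x j := ∑ i : Fin k, x (Fin.castAdd r i) * A i j -
    if h : (j : ℕ) < r then x (Fin.natAdd k ⟨j, h⟩) else 0
  map_add' x y := by
    ext j
    by_cases h : (j : ℕ) < r
    · simp [h, add_mul, Finset.sum_add_distrib]; ring
    · simp [h, add_mul, Finset.sum_add_distrib]
  map_smul' t x := by
    ext j
    by_cases h : (j : ℕ) < r <;> simp [h, mul_assoc, Finset.mul_sum, mul_sub]

lemma coe_ker_ecSyndrome {F : Type} [Field F] {k v : ℕ} (A : Matrix (Fin k) (Fin v) F) (r : ℕ)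
    (hrv : r ≤ v) : (LinearMap.ker (ecSyndrome A r) : Set (Fin (k + r) → F)) = ECCode A r hrv := by
  ext x
  simp only [SetLike.mem_coe, LinearMap.mem_ker, ECCode, Set.mem_ofPred_eq]
  constructor
  · intro h
    refine ⟨fun j => ?_, fun j hj => ?_⟩
    · simpa [ecSyndrome, sub_eq_zero, -Fin.natAdd_mk] using congrFun h (Fin.castLE hrv j)
    · simpa [ecSyndrome, not_lt.2 hj] using congrFun h j
  · rintro ⟨h₁, h₂⟩
    ext j
    by_cases hj : (j : ℕ) < r
    · simpa [ecSyndrome, hj, sub_eq_zero] using h₁ ⟨j, hj⟩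
    · simpa [ecSyndrome, hj] using h₂ j (not_lt.1 hj)

/-- Every nonzero word of an extended Cauchy code has Hamming norm greater than `v`. -/
lemma lt_hammingNorm_of_mem_ecCode {F : Type} [Field F] [DecidableEq F] {k v r : ℕ} (hrv : r ≤ v)
    (a : Fin k → F) (b : Fin v → F) (c : Fin k → F) (d : Fin v → F)
    (hdist : Function.Injective (Sum.elim a b))
    (hc : ∀ i, c i ≠ 0) (hd : ∀ j, d j ≠ 0) (A : Matrix (Fin k) (Fin v) F)
    (hA : ∀ i j, A i j = c i * d j / (a i - b j))
    {x : Fin (k + r) → F} (hx : x ∈ ECCode A r hrv) (hx0 : x ≠ 0) : v < hammingNorm x := by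
  obtain ⟨hx₁, hx₂⟩ := hx
  obtain ⟨ha, hb, hab⟩ := Sum.elim_injective.1 hdist
  by_contra! hle
  rw [hammingNorm_fin_add] at hle
  let σ : Fin v → F := fun j => ∑ i : Fin k, x (Fin.castAdd r i) * A i j
  let S : Finset (Fin k) := {i | x (Fin.castAdd r i) ≠ 0}
  let Z : Finset (Fin v) := {j | σ j = 0}
  have hσ : (Finset.univ.filter fun j => ¬ σ j = 0).card ≤
      hammingNorm fun j => x (Fin.natAdd k j) := by
    rw [hammingNorm, ← Finset.card_map (Fin.castLEEmb hrv)]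
    refine Finset.card_le_card fun j hj => ?_
    have hj' : σ j ≠ 0 := by simpa using hj
    have hjr : (j : ℕ) < r := not_le.1 fun h => hj' (hx₂ j h)
    refine Finset.mem_map.2 ⟨⟨j, hjr⟩, ?_, rfl⟩
    exact Finset.mem_filter.2 ⟨Finset.mem_univ _, fun h => hj' ((hx₁ ⟨j, hjr⟩).trans h)⟩
  have hcard : Z.card + (Finset.univ.filter fun j => ¬ σ j = 0).card = v := by
    simpa using Finset.card_filter_add_card_filter_not (s := Finset.univ) fun j => σ j = 0
  have hS : S.card = hammingNorm fun i => x (Fin.castAdd r i) := rfl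
  have hvanish := eq_zero_of_sum_div_sub_eq_zero S (Z.map ⟨b, hb⟩) a
    (fun i => x (Fin.castAdd r i) * c i) ha.injOn ?_ ?_ ?_
  · have hleft : ∀ i, x (Fin.castAdd r i) = 0 := by
      intro i
      by_contra hi
      exact mul_ne_zero hi (hc i) (hvanish i (by simpa [S] using hi))
    refine hx0 (funext fun i => Fin.addCases hleft (fun j => ?_) i)
    simp [← hx₁ j, hleft]
  · intro i _ z hz
    obtain ⟨j, _, rfl⟩ := Finset.mem_map.1 hz
    exact hab i j
  · rw [Finset.card_map]
    omega
  · intro z hz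
    obtain ⟨j, hj, rfl⟩ := Finset.mem_map.1 hz
    have hj' : σ j = 0 := by simpa [Z] using hj
    refine (mul_eq_zero.1 ?_).resolve_left (hd j)
    rw [← hj', Finset.mul_sum]
    refine (Finset.sum_subset (Finset.subset_univ S) fun i _ hi => ?_).trans
      (Finset.sum_congr rfl fun i _ => ?_)
    · have hi' : x (Fin.castAdd r i) = 0 := by simpa [S] using hi
      simp [hi']
    · rw [hA]
      simp only [Function.Embedding.coeFn_mk]
      ring

/-- for `v − k < r ≤ v`, the EC code `C(A,k,v,r)` is an `F`-linear subspace
of `F^{k+r}` of dimension `k + r − v`, and every nonzero codeword has Hamming weight at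
least `v + 1`; i.e. it is an MDS code with parameters `(k+r, k+r−v, v+1)`. -/
theorem ec_code_MDS {F : Type} [Field F] [Fintype F] [DecidableEq F]
    (k v r : ℕ) (hk : 0 < k) (hr : 0 < r) (hrv : r ≤ v) (hvk : v - k < r)
    (a : Fin k → F) (b : Fin v → F) (c : Fin k → F) (d : Fin v → F)
    (hdist : Function.Injective (Sum.elim a b))
    (hc : ∀ i, c i ≠ 0) (hd : ∀ j, d j ≠ 0)
    (A : Matrix (Fin k) (Fin v) F)
    (hA : ∀ i j, A i j = c i * d j / (a i - b j)) :
    ∃ Code : Submodule F (Fin (k + r) → F),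
      (Code : Set (Fin (k + r) → F)) = ECCode A r hrv ∧
      Module.finrank F Code = k + r - v ∧
      ∀ x ∈ ECCode A r hrv, x ≠ 0 → v + 1 ≤ hammingNorm x := by
  have hweight : ∀ x ∈ ECCode A r hrv, x ≠ 0 → v < hammingNorm x := fun x hx hx0 =>
    lt_hammingNorm_of_mem_ecCode hrv a b c d hdist hc hd A hA hx hx0
  have hker := coe_ker_ecSyndrome A r hrv
  refine ⟨LinearMap.ker (ecSyndrome A r), hker, le_antisymm ?_ ?_, hweight⟩
  · refine finrank_le_of_lt_hammingNorm (by omega) _ fun x hx => hweight x ?_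
    rwa [← hker]
  · have hrank := LinearMap.finrank_range_add_finrank_ker (ecSyndrome A r)
    have hrange := Submodule.finrank_le (LinearMap.range (ecSyndrome A r))
    rw [Module.finrank_fin_fun] at hrank hrange
    omega
end

section
/- Assume the syndrome setup. Let I ⊆ {1,…,k} and J ⊆ {1,…,r}, let E_I ⊆ I and E_J ⊆ J with t = |E_I| + |E_J|, and assume 2(|I| + |J| − t) + t ≤ v. Suppose S = Σ_{i∈I} β_i h_i + Σ_{j∈J} γ_j g_j for some nonzero scalars β_i, γ_j ∈ F. Let e_E(X) = ∏_{i∈E_I}(X − a_i) · ∏_{j∈E_J}(X − b_j), let s = ⌊(v−t)/2⌋ and s' = ⌈(v−t)/2⌉, and fix W_0 ⊆ {1,…,v} with |W_0| = s + t; enumerate {1,…,v} ∖ W_0 = {w_1,…,w_{s'}} and set W_i = W_0 ∪ {w_i}. Define the s'×(s+1) matrix F̃ over F by F̃_{i,j} = Σ_{w ∈ W_i} S_w · e_E(b_w) · b_w^{s+1−j} / ∏_{i'∈W_i, i'≠w}(b_w − b_{i'}) for i ∈ {1,…,s'} and j ∈ {1,…,s+1}; let u ∈ F^{s'} be the first column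 of F̃ and let M ∈ F^{s'×s} consist of its remaining s columns. For σ = (σ_1,…,σ_s) ∈ F^s set g(X;σ) = X^s + σ_1X^{s−1} + ⋯ + σ_{s−1}X + σ_s, and assume g(X;σ) is separable and gcd(g(X;σ), e_E) = 1. Then ∏_{i∈I∖E_I}(X − a_i) · ∏_{j∈J∖E_J}(X − b_j) divides g(X;σ) if and only if M·σ = −u. -/
open Polynomial

open Finset in
/-- All divided differences on the one-point extensions of `s` vanish iff the values are those of
a polynomial of degree less than `#s`. -/
theorem forall_sum_div_prod_sub_eq_zero_iff {F ι : Type*} [Field F] [DecidableEq ι]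
    {b : ι → F} (hb : Function.Injective b) (s : Finset ι) (f : ι → F) :
    (∀ l ∉ s, ∑ w ∈ insert l s, f w / ∏ i ∈ (insert l s).erase w, (b w - b i) = 0) ↔
      ∃ p : F[X], p.degree < s.card ∧ ∀ w, p.eval (b w) = f w := by
  have key (p : F[X]) (hp : p.degree < s.card) (hps : ∀ w ∈ s, p.eval (b w) = f w) (l : ι)
      (hl : l ∉ s) :
      ∑ w ∈ insert l s, f w / ∏ i ∈ (insert l s).erase w, (b w - b i) = 0 ↔
        p.eval (b l) = f l := by
    have hcard : (insert l s).card = s.card + 1 := card_insert_of_notMem hl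
    have hp' : p.degree < (insert l s).card :=
      hp.trans (by rw [hcard]; exact_mod_cast Nat.lt_succ_self _)
    have hz := Lagrange.coeff_eq_sum hb.injOn hp'
    rw [hcard, Nat.add_sub_cancel, coeff_eq_zero_of_degree_lt hp] at hz
    conv_lhs => rhs; rw [hz]
    rw [← sub_eq_zero, ← sum_sub_distrib, sum_insert hl,
      sum_eq_zero (s := s) fun w hw => by rw [hps w hw, sub_self], add_zero, ← sub_div,
      div_eq_zero_iff, or_iff_left, sub_eq_zero, eq_comm]
    refine prod_ne_zero_iff.2 fun i hi => sub_ne_zero.2 fun h => ?_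
    exact ne_of_mem_erase hi (hb h).symm
  constructor
  · intro h
    have hp := Lagrange.degree_interpolate_lt f (s := s) hb.injOn
    have hps : ∀ w ∈ s, (Lagrange.interpolate s b f).eval (b w) = f w := fun w hw =>
      Lagrange.eval_interpolate_at_node f hb.injOn hw
    refine ⟨_, hp, fun w => ?_⟩
    by_cases hw : w ∈ s
    · exact hps w hw
    · exact (key _ hp hps w hw).1 (h w hw)
  · rintro ⟨p, hp, hpf⟩ l hl
    exact (key p hp (fun w _ => hpf w) l hl).2 (hpf l)

theorem Lagrange.nodal_dvd_iff {F ι : Type*} [Field F] {a : ι → F} (ha : Function.Injective a)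
    (s : Finset ι) (g : F[X]) :
    Lagrange.nodal s a ∣ g ↔ ∀ i ∈ s, g.eval (a i) = 0 := by
  refine ⟨fun h i hi => ?_, fun h => ?_⟩
  · exact dvd_iff_isRoot.1 ((Lagrange.X_sub_C_dvd_nodal a hi).trans h)
  · refine Finset.prod_dvd_of_coprime (fun i _ j _ hij => ?_) fun i hi => dvd_iff_isRoot.2 (h i hi)
    exact pairwise_coprime_X_sub_C ha hij

/-- The numerator of the rational function `∑ i ∈ I, β i / (a i - X)` over the denominator
`∏ i ∈ I, (X - a i)`. -/
noncomputable def evaluator {F ι : Type*} [Field F] [DecidableEq ι] (a β : ι → F)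
    (I : Finset ι) : F[X] :=
  -∑ i ∈ I, C (β i) * Lagrange.nodal (I.erase i) a

theorem degree_evaluator_lt {F ι : Type*} [Field F] [DecidableEq ι] (a β : ι → F)
    (I : Finset ι) : (evaluator a β I).degree < I.card := by
  rw [evaluator, degree_neg, ← mem_degreeLT]
  refine Submodule.sum_mem _ fun i hi => ?_
  rw [C_mul']
  refine Submodule.smul_mem _ _ ?_
  rw [mem_degreeLT, Lagrange.degree_nodal]
  exact_mod_cast Finset.card_erase_lt_of_mem hi

theorem eval_evaluator {F ι : Type*} [Field F] [DecidableEq ι] (a β : ι → F)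
    (I : Finset ι) {x : F} (hx : ∀ i ∈ I, a i ≠ x) :
    (evaluator a β I).eval x =
      (∑ i ∈ I, β i * (a i - x)⁻¹) * (Lagrange.nodal I a).eval x := by
  simp only [evaluator, eval_neg, eval_finsetSum, eval_mul, eval_C, Lagrange.eval_nodal,
    Finset.sum_mul, ← Finset.sum_neg_distrib]
  refine Finset.sum_congr rfl fun i hi => ?_
  rw [← Finset.mul_prod_erase _ _ hi]
  have := sub_ne_zero.2 (hx i hi)
  field_simp
  ring

theorem eval_evaluator_ne_zero {F ι : Type*} [Field F] [DecidableEq ι] {a β : ι → F}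
    (ha : Function.Injective a) {I : Finset ι} {i : ι} (hi : i ∈ I) (hβ : β i ≠ 0) :
    (evaluator a β I).eval (a i) ≠ 0 := by
  simp only [evaluator, eval_neg, eval_finsetSum, eval_mul, eval_C, Lagrange.eval_nodal]
  rw [neg_ne_zero, Finset.sum_eq_single i]
  · refine mul_ne_zero hβ (Finset.prod_ne_zero_iff.2 fun j hj => sub_ne_zero.2 fun h => ?_)
    exact Finset.ne_of_mem_erase hj (ha h).symm
  · intro j _ hji
    rw [Finset.prod_eq_zero (Finset.mem_erase.2 ⟨hji.symm, hi⟩) (sub_self _), mul_zero]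
  · exact fun h => absurd hi h

open Finset Lagrange in
/-- The error locator divides `g` iff the values `S w * eE (b w) * g (b w)` are those of a polynomial
of degree less than `g.natDegree + t`. -/
theorem nodal_mul_nodal_dvd_iff_exists_interpolant {F κ ρ ι : Type*} [Field F] [DecidableEq κ]
    [DecidableEq ρ] [Fintype ι] {a : κ → F} {b : ι → F} {e : ρ → ι}
    (ha : Function.Injective a) (hb : Function.Injective b) (he : Function.Injective e)
    (hab : ∀ i w, a i ≠ b w) {I EI : Finset κ} {J EJ : Finset ρ} (hEI : EI ⊆ I) (hEJ : EJ ⊆ J)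
    {β : κ → F} {γ : ρ → F} (hβ : ∀ i ∈ I, β i ≠ 0) (hγ : ∀ j ∈ J, γ j ≠ 0) {S : ι → F}
    (hS_range : ∀ j ∈ J, S (e j) = ∑ i ∈ I, β i * (a i - b (e j))⁻¹ + γ j)
    (hS : ∀ w, (∀ j ∈ J, e j ≠ w) → S w = ∑ i ∈ I, β i * (a i - b w)⁻¹)
    {g : F[X]} (hg : g ≠ 0)
    (hcard : #(I \ EI) + #(J \ EJ) + (#EI + #EJ) + g.natDegree ≤ Fintype.card ι) :
    nodal (I \ EI) a * nodal (J \ EJ) (b ∘ e) ∣ g ↔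
      ∃ p : F[X], p.degree < (g.natDegree + (#EI + #EJ) : ℕ) ∧
        ∀ w, p.eval (b w) = S w * (nodal EI a * nodal EJ (b ∘ e)).eval (b w) * g.eval (b w) := by
  have hbe : Function.Injective (b ∘ e) := hb.comp he
  have hI : nodal I a = nodal (I \ EI) a * nodal EI a := (prod_sdiff hEI).symm
  have hJ : nodal J (b ∘ e) = nodal (J \ EJ) (b ∘ e) * nodal EJ (b ∘ e) := (prod_sdiff hEJ).symm
  have hcI := card_sdiff_add_card_eq_card hEI
  have hcJ := card_sdiff_add_card_eq_card hEJ
  set N := evaluator a β I with hN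
  have hNdeg : N.degree < #I := degree_evaluator_lt a β I
  have hNb (w : ι) : N.eval (b w) =
      (∑ i ∈ I, β i * (a i - b w)⁻¹) * (nodal I a).eval (b w) :=
    eval_evaluator a β I fun i _ => hab i w
  have hkey (w : ι) : S w * (nodal I a).eval (b w) * (nodal J (b ∘ e)).eval (b w) =
      N.eval (b w) * (nodal J (b ∘ e)).eval (b w) := by
    by_cases hw : ∃ j ∈ J, e j = w
    · obtain ⟨j, hj, rfl⟩ := hw
      have : (nodal J (b ∘ e)).eval (b (e j)) = 0 := eval_nodal_at_node (v := b ∘ e) hj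
      rw [this, mul_zero, mul_zero]
    · push Not at hw
      rw [hS w hw, hNb]
  have hdeg (q : F[X]) (n : ℕ) (hq : q.degree < n) (p : F[X]) (hp : p ≠ 0) :
      (q * p).degree < (n + p.natDegree : ℕ) := by
    rw [degree_mul, degree_eq_natDegree hp, Nat.cast_add]
    exact WithBot.add_lt_add_right (by simp) hq
  constructor
  · rintro ⟨h, rfl⟩
    refine ⟨N * (nodal J (b ∘ e) * h), ?_, fun w => ?_⟩
    · have hh : h ≠ 0 := right_ne_zero_of_mul hg
      have := hdeg N _ hNdeg (nodal J (b ∘ e) * h) (mul_ne_zero nodal_ne_zero hh)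
      refine this.trans_le ?_
      rw [natDegree_mul nodal_ne_zero hh, natDegree_mul (mul_ne_zero nodal_ne_zero nodal_ne_zero) hh,
        natDegree_mul nodal_ne_zero nodal_ne_zero]
      simp only [natDegree_nodal]
      exact_mod_cast (by omega)
    · have := hkey w
      simp only [hI, hJ, eval_mul] at this ⊢
      linear_combination -(eval (b w) h) * this
  · rintro ⟨p, hp, hpS⟩
    have hpD : p * (nodal (I \ EI) a * nodal (J \ EJ) (b ∘ e)) = N * (nodal J (b ∘ e) * g) := by
      refine eq_of_degrees_lt_of_eval_index_eq (s := univ) (v := b) hb.injOn ?_ ?_ fun w _ => ?_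
      · refine (hdeg p _ hp _ (mul_ne_zero nodal_ne_zero nodal_ne_zero)).trans_le ?_
        rw [natDegree_mul nodal_ne_zero nodal_ne_zero]
        simp only [natDegree_nodal, card_univ]
        exact_mod_cast (by omega)
      · refine (hdeg N _ hNdeg _ (mul_ne_zero nodal_ne_zero hg)).trans_le ?_
        rw [natDegree_mul nodal_ne_zero hg]
        simp only [natDegree_nodal, card_univ]
        exact_mod_cast (by omega)
      · have h1 := hkey w
        have h2 := hpS w
        simp only [hI, hJ, eval_mul] at h1 h2 ⊢
        rw [h2]
        linear_combination (eval (b w) g) * h1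
    have hpA : p * nodal (I \ EI) a = N * (nodal EJ (b ∘ e) * g) := by
      refine mul_right_cancel₀ (nodal_ne_zero (s := J \ EJ) (v := b ∘ e)) ?_
      rw [hJ] at hpD
      linear_combination hpD
    refine IsCoprime.mul_dvd ?_ ((nodal_dvd_iff ha _ _).2 fun i hi => ?_)
      ((nodal_dvd_iff hbe _ _).2 fun j hj => ?_)
    · refine IsCoprime.prod_left fun i _ => IsCoprime.prod_right fun j _ => ?_
      exact isCoprime_X_sub_C_of_isUnit_sub (sub_ne_zero.2 (hab i (e j))).isUnit
    · have h := congrArg (eval (a i)) hpA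
      rw [eval_mul, eval_nodal_at_node hi, mul_zero, eval_mul, eval_mul, eq_comm, mul_eq_zero,
        mul_eq_zero] at h
      have hiI := (mem_sdiff.1 hi).1
      exact (h.resolve_left (eval_evaluator_ne_zero ha hiI (hβ i hiI))).resolve_left
        (eval_nodal_not_at_node fun j _ => hab i (e j))
    · obtain ⟨hjJ, hjE⟩ := mem_sdiff.1 hj
      have h := congrArg (eval (b (e j))) hpA
      have hIne : (nodal I a).eval (b (e j)) ≠ 0 :=
        eval_nodal_not_at_node fun i _ => (hab i (e j)).symm
      have hEne : (nodal EJ (b ∘ e)).eval (b (e j)) ≠ 0 :=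
        eval_nodal_not_at_node fun j' hj' hjj => hjE (hbe (a₁ := j) hjj ▸ hj')
      rw [eval_mul, eval_mul, eval_mul, hpS, hNb, hS_range j hjJ, hI, eval_mul, eval_mul] at h
      have h0 : γ j * (nodal I a).eval (b (e j)) * (nodal EJ (b ∘ e)).eval (b (e j)) *
          g.eval (b (e j)) = 0 := by
        rw [hI, eval_mul]
        linear_combination h
      exact (mul_eq_zero.1 h0).resolve_left (mul_ne_zero (mul_ne_zero (hγ j hjJ) hIne) hEne)


/-- in the syndrome setup, with erasure sets `EI ⊆ I`, `EJ ⊆ J`,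
`t = |EI| + |EJ|`, `2(|I|+|J|−t)+t ≤ v`, a syndrome `S` supported on `I, J` with nonzero
coefficients, erasure locator `eE`, `s = ⌊(v−t)/2⌋`, a set `W₀` of size `s + t`, the
matrix `F̃` (first column `u`, remaining columns `M`), and a monic separable candidate
polynomial `g(X;σ)` coprime to `eE`: the error locator divides `g(X;σ)` iff `M·σ = −u`. -/
theorem error_locator_dvd_iff_linear_system {F : Type} [Field F] [Fintype F]
    (k v r : ℕ) (hrv : r ≤ v)
    (a : Fin k → F) (b : Fin v → F)
    (hdist : Function.Injective (Sum.elim a b))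
    (hvec : Fin k → Fin v → F) (hhvec : ∀ i w, hvec i w = (a i - b w)⁻¹)
    (gstd : Fin r → Fin v → F) (hgstd : ∀ j, gstd j = Pi.single (Fin.castLE hrv j) 1)
    (I : Finset (Fin k)) (J : Finset (Fin r))
    (EI : Finset (Fin k)) (EJ : Finset (Fin r)) (hEI : EI ⊆ I) (hEJ : EJ ⊆ J)
    (t : ℕ) (ht : t = EI.card + EJ.card)
    (hbound : 2 * (I.card + J.card - t) + t ≤ v)
    (β : Fin k → F) (γ : Fin r → F)
    (hβ : ∀ i ∈ I, β i ≠ 0) (hγ : ∀ j ∈ J, γ j ≠ 0)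
    (S : Fin v → F)
    (hS : S = ∑ i ∈ I, β i • hvec i + ∑ j ∈ J, γ j • gstd j)
    (eE : Polynomial F)
    (heE : eE = (∏ i ∈ EI, (X - C (a i))) * ∏ j ∈ EJ, (X - C (b (Fin.castLE hrv j))))
    (s : ℕ) (hs : s = (v - t) / 2)
    (W0 : Finset (Fin v)) (hW0 : W0.card = s + t)
    (Ft : Fin v → Fin (s + 1) → F)
    (hFt : ∀ l j, Ft l j = ∑ w ∈ insert l W0,
      S w * eE.eval (b w) * (b w) ^ (s + 1 - ((j : ℕ) + 1)) /
        ∏ i ∈ (insert l W0).erase w, (b w - b i))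
    (σ : Fin s → F)
    (g : Polynomial F)
    (hg : g = X ^ s + ∑ m : Fin s, C (σ m) * X ^ (s - 1 - (m : ℕ)))
    (hgsep : g.Separable) (hgcop : IsCoprime g eE) :
    ((∏ i ∈ I \ EI, (X - C (a i))) * ∏ j ∈ J \ EJ, (X - C (b (Fin.castLE hrv j)))) ∣ g ↔
      ∀ l ∈ Finset.univ \ W0, ∑ j : Fin s, Ft l j.succ * σ j = - Ft l 0 := by
  have hb : Function.Injective b := hdist.comp Sum.inr_injective
  have ha : Function.Injective a := hdist.comp Sum.inl_injective
  have hab (i : Fin k) (w : Fin v) : a i ≠ b w := fun h =>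
    Sum.inl_ne_inr (hdist (a₁ := Sum.inl i) (a₂ := Sum.inr w) h)
  have he : Function.Injective (Fin.castLE hrv) := Fin.castLE_injective hrv
  have hSw (w : Fin v) : S w = ∑ i ∈ I, β i * (a i - b w)⁻¹ +
      ∑ j ∈ J, γ j * (Pi.single (Fin.castLE hrv j) (1 : F) : Fin v → F) w := by
    simp [hS, hhvec, hgstd, Finset.sum_apply]
  have htail : (∑ m : Fin s, C (σ m) * X ^ (s - 1 - (m : ℕ))).degree < (s : WithBot ℕ) := by
    rw [← mem_degreeLT]
    refine Submodule.sum_mem _ fun m _ => mem_degreeLT.2 ?_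
    refine (degree_C_mul_X_pow_le _ _).trans_lt ?_
    exact_mod_cast (by have := m.isLt; omega)
  have hgdeg : g.degree = s := by
    rw [hg, degree_add_eq_left_of_degree_lt] <;> rw [degree_X_pow]
    exact htail
  have hgnat : g.natDegree = s := natDegree_eq_of_degree_eq_some hgdeg
  have hg0 : g ≠ 0 := hgsep.ne_zero
  have hcI := Finset.card_sdiff_add_card_eq_card hEI
  have hcJ := Finset.card_sdiff_add_card_eq_card hEJ
  have hcore := nodal_mul_nodal_dvd_iff_exists_interpolant (S := S) ha hb he hab hEI hEJ hβ hγ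
    (fun j hj => by
      rw [hSw, Finset.sum_eq_single_of_mem j hj, Pi.single_eq_same, mul_one]
      intro j' _ hj'
      rw [Pi.single_eq_of_ne (fun h => hj' (he h).symm), mul_zero])
    (fun w hw => by
      rw [hSw, add_eq_left]
      refine Finset.sum_eq_zero fun j hj => ?_
      rw [Pi.single_eq_of_ne (hw j hj).symm, mul_zero])
    hg0 (by rw [hgnat, Fintype.card_fin]; omega)
  rw [hgnat, ← ht, ← hW0, ← forall_sum_div_prod_sub_eq_zero_iff hb W0] at hcore
  refine hcore.trans (forall_congr' fun l => ?_)
  rw [Finset.mem_sdiff, and_iff_right (Finset.mem_univ l), ← add_eq_zero_iff_eq_neg]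
  refine imp_congr_right fun _ => ?_
  have hrow : ∑ w ∈ insert l W0, S w * eE.eval (b w) * g.eval (b w) /
        ∏ i ∈ (insert l W0).erase w, (b w - b i) =
      ∑ j : Fin s, Ft l j.succ * σ j + Ft l 0 := by
    simp only [hFt, Finset.sum_mul]
    rw [Finset.sum_comm, ← Finset.sum_add_distrib]
    refine Finset.sum_congr rfl fun w _ => ?_
    simp only [hg, eval_add, eval_pow, eval_X, eval_finsetSum, eval_mul, eval_C, Fin.val_succ,
      Fin.val_zero, zero_add, Nat.add_sub_cancel, mul_add, add_div, Finset.mul_sum,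
      Finset.sum_div]
    rw [add_comm]
    congr 1
    refine Finset.sum_congr rfl fun m _ => ?_
    rw [show s + 1 - ((m : ℕ) + 1 + 1) = s - 1 - m by omega]
    ring
  rw [← hrow, heE]
  rfl
end

section
/- Assume the syndrome setup. Let I ⊆ {1,…,k} and J ⊆ {1,…,r}, and let S ∈ F^v lie in the F-linear span of {h_i : i ∈ I} ∪ {g_j : j ∈ J}. Let f ∈ F[X] be a nonzero separable polynomial such that ∏_{i∈I}(X − a_i) · ∏_{j∈J}(X − b_j) divides f. Then for every subset W ⊆ {1,…,v} with |W| = deg(f) + 1, the following holds in F: Σ_{w∈W} S_w · f(b_w) / ∏_{i∈W, i≠w}(b_w − b_i) = 0. -/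
open Polynomial

/-- The divided difference of order `deg f` annihilates the vector `(f(c w) / (x - c w))_w` when
`x` is a root of `f`. -/
theorem sum_inv_sub_mul_eval_div_prod_eq_zero {F ι : Type*} [Field F] [DecidableEq ι] {c : ι → F}
    {W : Finset ι} (hc : Set.InjOn c W) {x : F} (hx : ∀ w ∈ W, x ≠ c w) {f : F[X]} (hf : f ≠ 0)
    (hroot : X - C x ∣ f) (hW : W.card = f.natDegree + 1) :
    ∑ w ∈ W, (x - c w)⁻¹ * f.eval (c w) / ∏ i ∈ W.erase w, (c w - c i) = 0 := by
  obtain ⟨q, rfl⟩ := hroot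
  have hq : q ≠ 0 := right_ne_zero_of_mul hf
  rw [natDegree_mul (X_sub_C_ne_zero x) hq, natDegree_X_sub_C] at hW
  have hdeg : q.degree < W.card := by
    rw [degree_eq_natDegree hq]
    exact_mod_cast (by omega : q.natDegree < W.card)
  have hcoeff := Lagrange.coeff_eq_sum hc hdeg
  rw [coeff_eq_zero_of_natDegree_lt (by omega)] at hcoeff
  rw [← neg_eq_zero, ← Finset.sum_neg_distrib, hcoeff]
  refine Finset.sum_congr rfl fun w hw => ?_
  have hxw : x - c w ≠ 0 := sub_ne_zero.mpr (hx w hw)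
  rw [← neg_div, eval_mul, eval_sub, eval_X, eval_C, ← neg_sub x (c w), neg_mul, mul_neg, neg_neg,
    inv_mul_cancel_left₀ hxw]

/-- in the syndrome setup, if `S` lies in the span of `{h_i : i ∈ I} ∪
{g_j : j ∈ J}` and `f` is a nonzero separable polynomial divisible by the full error
locator `∏_{i∈I}(X − a_i)·∏_{j∈J}(X − b_j)`, then for every `W ⊆ {1,…,v}` with
`|W| = deg f + 1`, `Σ_{w∈W} S_w · f(b_w) / ∏_{i∈W, i≠w}(b_w − b_i) = 0`. -/
theorem syndrome_locator_sum_eq_zero {F : Type} [Field F] [Fintype F]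
    (k v r : ℕ) (hrv : r ≤ v)
    (a : Fin k → F) (b : Fin v → F)
    (hdist : Function.Injective (Sum.elim a b))
    (hvec : Fin k → Fin v → F) (hhvec : ∀ i w, hvec i w = (a i - b w)⁻¹)
    (gstd : Fin r → Fin v → F) (hgstd : ∀ j, gstd j = Pi.single (Fin.castLE hrv j) 1)
    (I : Finset (Fin k)) (J : Finset (Fin r))
    (S : Fin v → F)
    (hS : S ∈ Submodule.span F ((hvec '' ↑I) ∪ (gstd '' ↑J)))
    (f : Polynomial F) (hf0 : f ≠ 0) (hsep : f.Separable)
    (hdvd : ((∏ i ∈ I, (X - C (a i))) * ∏ j ∈ J, (X - C (b (Fin.castLE hrv j)))) ∣ f) :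
    ∀ W : Finset (Fin v), W.card = f.natDegree + 1 →
      ∑ w ∈ W, S w * f.eval (b w) / ∏ i ∈ W.erase w, (b w - b i) = 0 := by
  intro W hW
  induction hS using Submodule.span_induction with
  | mem S hS =>
    rcases hS with ⟨i, hi, rfl⟩ | ⟨j, hj, rfl⟩
    · simp only [hhvec]
      refine sum_inv_sub_mul_eval_div_prod_eq_zero
        (hdist.comp Sum.inr_injective).injOn (fun w _ h => ?_) hf0
        ((Finset.dvd_prod_of_mem (fun i => X - C (a i)) hi).trans
          ((dvd_mul_right _ _).trans hdvd)) hW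
      exact Sum.inl_ne_inr (hdist (a₁ := Sum.inl i) (a₂ := Sum.inr w) h)
    · have hroot : f.eval (b (Fin.castLE hrv j)) = 0 :=
        dvd_iff_isRoot.mp <|
          (Finset.dvd_prod_of_mem (fun j => X - C (b (Fin.castLE hrv j))) hj).trans
            ((dvd_mul_left _ _).trans hdvd)
      refine Finset.sum_eq_zero fun w _ => ?_
      rcases eq_or_ne w (Fin.castLE hrv j) with rfl | hw
      · simp [hroot]
      · simp [hgstd, hw]
  | zero => simp
  | add S T _ _ hS hT =>
    simp only [Pi.add_apply, add_mul, add_div, Finset.sum_add_distrib, hS, hT, add_zero]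
  | smul t S _ hS =>
    simp only [Pi.smul_apply, smul_eq_mul, mul_assoc, mul_div_assoc, ← Finset.mul_sum] at hS ⊢
    rw [hS, mul_zero]
end

section
/- Assume the syndrome setup. Let I ⊆ {1,…,k} and J ⊆ {1,…,r}, let E_I ⊆ I and E_J ⊆ J with t = |E_I| + |E_J|, and assume 2(|I| + |J| − t) + t ≤ v. Suppose S = Σ_{i∈I} β_i h_i + Σ_{j∈J} γ_j g_j for some nonzero scalars β_i, γ_j ∈ F. Let f ∈ F[X] be a nonzero separable polynomial with deg(f) = ⌊(v+t)/2⌋ such that ∏_{i∈E_I}(X − a_i) · ∏_{j∈E_J}(X − b_j) divides f. Fix W_0 ⊆ {1,…,v} with |W_0| = deg(f). Then ∏_{i∈I}(X − a_i) · ∏_{j∈J}(X − b_j) divides f if and only if for every l ∈ {1,…,v} ∖ W_0, setting W = W_0 ∪ {l}, one has Σ_{w∈W} S_w · f(b_w) / ∏_{i∈W, i≠w}(b_w − b_i) = 0. -/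
open Polynomial

/-- A product of distinct linear factors divides `f` exactly when all their roots are roots
of `f`. -/
theorem prod_X_sub_C_dvd_iff_forall_isRoot {F ι : Type*} [Field F] {c : ι → F}
    (hc : Function.Injective c) (s : Finset ι) (f : F[X]) :
    (∏ i ∈ s, (X - C (c i))) ∣ f ↔ ∀ i ∈ s, f.eval (c i) = 0 := by
  refine ⟨fun h i hi => dvd_iff_isRoot.1
    ((Finset.dvd_prod_of_mem (fun i => X - C (c i)) hi).trans h), fun h => ?_⟩
  exact Finset.prod_dvd_of_coprime ((pairwise_coprime_X_sub_C hc).set_pairwise _)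
    fun i hi => dvd_iff_isRoot.2 (h i hi)

theorem prod_mul_prod_X_sub_C_dvd_iff {F ι κ : Type*} [Field F] {a : ι → F} {b : κ → F}
    (hab : Function.Injective (Sum.elim a b)) (s : Finset ι) (t : Finset κ) (f : F[X]) :
    ((∏ i ∈ s, (X - C (a i))) * ∏ j ∈ t, (X - C (b j))) ∣ f ↔
      (∀ i ∈ s, f.eval (a i) = 0) ∧ ∀ j ∈ t, f.eval (b j) = 0 := by
  simpa [Finset.prod_disjSum] using prod_X_sub_C_dvd_iff_forall_isRoot hab (s.disjSum t) f

/-- All divided differences of `y` on the sets `insert l s` vanish exactly when `y` is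
interpolated by a polynomial of degree less than `#s`. -/
theorem forall_dividedDifference_eq_zero_iff {F ι : Type*} [Field F] [Fintype ι] [DecidableEq ι]
    {b : ι → F} (hb : Function.Injective b) (s : Finset ι) (y : ι → F) :
    (∀ l ∈ Finset.univ \ s,
      ∑ w ∈ insert l s, y w / ∏ i ∈ (insert l s).erase w, (b w - b i) = 0) ↔
      ∃ P : F[X], P.degree < s.card ∧ ∀ w, P.eval (b w) = y w := by
  constructor
  · intro h
    refine ⟨Lagrange.interpolate s b y, Lagrange.degree_interpolate_lt y hb.injOn, fun w => ?_⟩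
    by_cases hw : w ∈ s
    · exact Lagrange.eval_interpolate_at_node y hb.injOn hw
    set Q := Lagrange.interpolate (insert w s) b y with hQ
    have hcard : (insert w s).card = s.card + 1 := Finset.card_insert_of_notMem hw
    have hQdeg : Q.degree < (insert w s).card := Lagrange.degree_interpolate_lt y hb.injOn
    have hQeval : ∀ i ∈ insert w s, Q.eval (b i) = y i := fun i hi =>
      Lagrange.eval_interpolate_at_node y hb.injOn hi
    have hcoeff : Q.coeff s.card = 0 := by
      have := Lagrange.coeff_eq_sum hb.injOn hQdeg
      rw [hcard, Nat.add_sub_cancel] at this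
      rw [this, ← h w (by simp [hw])]
      exact Finset.sum_congr rfl fun i hi => by rw [hQeval i hi]
    have hQdeg' : Q.degree < s.card := by
      rw [degree_lt_iff_coeff_zero] at hQdeg ⊢
      intro m hm
      rcases hm.eq_or_lt with rfl | hm
      · exact hcoeff
      · exact hQdeg m (by omega)
    rw [← Lagrange.eq_interpolate_of_eval_eq y hb.injOn hQdeg'
      fun i hi => hQeval i (Finset.mem_insert_of_mem hi)]
    exact hQeval w (Finset.mem_insert_self w s)
  · rintro ⟨P, hP, hPy⟩ l hl
    have hl' : l ∉ s := by simpa using hl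
    have hcard : (insert l s).card = s.card + 1 := Finset.card_insert_of_notMem hl'
    have hdeg : P.degree < (insert l s).card :=
      hP.trans (by rw [hcard]; exact_mod_cast Nat.lt_succ_self _)
    have := Lagrange.coeff_eq_sum hb.injOn hdeg
    rw [hcard, Nat.add_sub_cancel, coeff_eq_zero_of_degree_lt hP] at this
    simpa [hPy] using this.symm

/-- A polynomial of small degree which, outside `t`, takes the values of a combination of Cauchy
vectors is zero, and so are the coefficients of the combination. -/
theorem eq_zero_of_eval_eq_sum_cauchy {F ι κ : Type*} [Field F] [Fintype ι]
    {a : κ → F} {b : ι → F} (hab : Function.Injective (Sum.elim a b))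
    (s : Finset κ) (t : Finset ι) {d : ℕ} (hd : d + (s.card + t.card) ≤ Fintype.card ι)
    {D : F[X]} (hD : D.degree < d) (c : κ → F)
    (h : ∀ w ∉ t, D.eval (b w) = ∑ i ∈ s, c i / (a i - b w)) :
    D = 0 ∧ ∀ i ∈ s, c i = 0 := by
  classical
  have ha : Function.Injective a := hab.comp Sum.inl_injective
  have hb : Function.Injective b := hab.comp Sum.inr_injective
  have hne : ∀ i w, a i ≠ b w := fun i w he =>
    Sum.inl_ne_inr (hab (a₁ := Sum.inl i) (a₂ := Sum.inr w) he)
  have hnodal : Lagrange.nodal s a * Lagrange.nodal t b ≠ 0 :=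
    mul_ne_zero Lagrange.nodal_ne_zero Lagrange.nodal_ne_zero
  have hLdeg : (Lagrange.nodal s a * Lagrange.nodal t b).degree = (s.card + t.card : ℕ) := by
    rw [degree_mul, Lagrange.degree_nodal, Lagrange.degree_nodal]; norm_cast
  have key : D * (Lagrange.nodal s a * Lagrange.nodal t b) =
      -∑ i ∈ s, C (c i) * (Lagrange.nodal (s.erase i) a * Lagrange.nodal t b) := by
    refine eq_of_degrees_lt_of_eval_index_eq Finset.univ hb.injOn ?_ ?_ ?_
    · by_cases hD0 : D = 0
      · simp [hD0]
      rw [degree_eq_natDegree hD0, Nat.cast_lt] at hD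
      rw [degree_mul, hLdeg, degree_eq_natDegree hD0, Finset.card_univ]
      norm_cast
      omega
    · rw [degree_neg, ← mem_degreeLT]
      refine Submodule.sum_mem _ fun i hi => mem_degreeLT.2 ?_
      rw [← smul_eq_C_mul]
      refine (degree_smul_le _ _).trans_lt ?_
      rw [degree_mul, Lagrange.degree_nodal, Lagrange.degree_nodal, Finset.card_univ,
        Finset.card_erase_of_mem hi]
      have := Finset.card_pos.2 ⟨i, hi⟩
      norm_cast
      omega
    · intro w _
      simp only [eval_mul, eval_neg, eval_finsetSum, eval_C]
      by_cases hw : w ∈ t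
      · simp [Lagrange.eval_nodal_at_node hw]
      rw [h w hw, Finset.sum_mul, ← Finset.sum_neg_distrib]
      refine Finset.sum_congr rfl fun i hi => ?_
      rw [Lagrange.nodal_eq_mul_nodal_erase hi]
      have := sub_ne_zero.2 (hne i w)
      simp only [eval_mul, eval_sub, eval_X, eval_C]
      field_simp
      ring
  have hc : ∀ i ∈ s, c i = 0 := by
    intro i hi
    have hi' := congrArg (eval (a i)) key
    simp only [eval_mul, eval_neg, eval_finsetSum, eval_C, Lagrange.eval_nodal_at_node hi,
      zero_mul, mul_zero] at hi'
    rw [Finset.sum_eq_single_of_mem i hi, eq_comm, neg_eq_zero] at hi'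
    · refine (mul_eq_zero.1 hi').resolve_right (mul_ne_zero ?_ ?_)
      · exact Lagrange.eval_nodal_not_at_node fun j hj =>
          ha.ne (Finset.ne_of_mem_erase hj).symm
      · exact Lagrange.eval_nodal_not_at_node fun j _ => hne i j
    · intro j _ hji
      rw [Lagrange.eval_nodal_at_node (Finset.mem_erase.2 ⟨hji.symm, hi⟩)]
      ring
  refine ⟨(mul_eq_zero.1 (key.trans ?_)).resolve_right hnodal, hc⟩
  rw [Finset.sum_eq_zero fun i hi => by simp [hc i hi], neg_zero]

theorem eval_div_sub_eq {F : Type*} [Field F] (f : F[X]) {x y : F} (hxy : x ≠ y) :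
    f.eval y / (x - y) = f.eval x / (x - y) - (f /ₘ (X - C x)).eval y := by
  have h := congrArg (eval y) (modByMonic_add_div f (X - C x))
  rw [modByMonic_X_sub_C_eq_C_eval] at h
  simp only [eval_add, eval_mul, eval_sub, eval_X, eval_C] at h
  have := sub_ne_zero.2 hxy
  rw [← h]
  field_simp
  ring

/-- in the syndrome setup, with erasure sets `EI ⊆ I`, `EJ ⊆ J`,
`t = |EI| + |EJ|`, `2(|I|+|J|−t)+t ≤ v`, a syndrome supported on `I, J` with nonzero
coefficients, and a nonzero separable `f` of degree `⌊(v+t)/2⌋` divisible by the erasure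
locator: the full error locator `∏_{i∈I}(X−a_i)·∏_{j∈J}(X−b_j)` divides `f` iff for every
`l ∉ W₀` (where `|W₀| = deg f`), setting `W = W₀ ∪ {l}`, one has
`Σ_{w∈W} S_w·f(b_w)/∏_{i∈W,i≠w}(b_w − b_i) = 0`. -/
theorem full_locator_dvd_iff_sums_vanish {F : Type} [Field F] [Fintype F]
    (k v r : ℕ) (hrv : r ≤ v)
    (a : Fin k → F) (b : Fin v → F)
    (hdist : Function.Injective (Sum.elim a b))
    (hvec : Fin k → Fin v → F) (hhvec : ∀ i w, hvec i w = (a i - b w)⁻¹)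
    (gstd : Fin r → Fin v → F) (hgstd : ∀ j, gstd j = Pi.single (Fin.castLE hrv j) 1)
    (I : Finset (Fin k)) (J : Finset (Fin r))
    (EI : Finset (Fin k)) (EJ : Finset (Fin r)) (hEI : EI ⊆ I) (hEJ : EJ ⊆ J)
    (t : ℕ) (ht : t = EI.card + EJ.card)
    (hbound : 2 * (I.card + J.card - t) + t ≤ v)
    (β : Fin k → F) (γ : Fin r → F)
    (hβ : ∀ i ∈ I, β i ≠ 0) (hγ : ∀ j ∈ J, γ j ≠ 0)
    (S : Fin v → F)
    (hS : S = ∑ i ∈ I, β i • hvec i + ∑ j ∈ J, γ j • gstd j)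
    (f : Polynomial F) (hf0 : f ≠ 0) (hsep : f.Separable)
    (hdeg : f.natDegree = (v + t) / 2)
    (hEdvd : ((∏ i ∈ EI, (X - C (a i))) * ∏ j ∈ EJ, (X - C (b (Fin.castLE hrv j)))) ∣ f)
    (W0 : Finset (Fin v)) (hW0 : W0.card = f.natDegree) :
    ((∏ i ∈ I, (X - C (a i))) * ∏ j ∈ J, (X - C (b (Fin.castLE hrv j)))) ∣ f ↔
      ∀ l ∈ Finset.univ \ W0,
        ∑ w ∈ insert l W0,
          S w * f.eval (b w) / ∏ i ∈ (insert l W0).erase w, (b w - b i) = 0 := by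
  have hb : Function.Injective b := hdist.comp Sum.inr_injective
  have hne : ∀ i w, a i ≠ b w := fun i w he =>
    Sum.inl_ne_inr (hdist (a₁ := Sum.inl i) (a₂ := Sum.inr w) he)
  have hdist' : Function.Injective (Sum.elim a fun j => b (Fin.castLE hrv j)) := by
    have := hdist.comp (Sum.map_injective.2
      ⟨Function.injective_id, Fin.castLE_injective hrv⟩)
    rwa [Sum.elim_comp_map] at this
  obtain ⟨hEa, hEb⟩ := (prod_mul_prod_X_sub_C_dvd_iff hdist' EI EJ f).1 hEdvd
  rw [forall_dividedDifference_eq_zero_iff hb W0 fun w => S w * f.eval (b w), hW0,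
    prod_mul_prod_X_sub_C_dvd_iff hdist' I J f]
  set Q : F[X] := -∑ i ∈ I, C (β i) * (f /ₘ (X - C (a i))) with hQ
  have hQdeg : Q.degree < f.natDegree := by
    rw [hQ, degree_neg, ← mem_degreeLT]
    refine Submodule.sum_mem _ fun i _ => mem_degreeLT.2 ?_
    rw [← smul_eq_C_mul]
    refine (degree_smul_le _ _).trans_lt ?_
    rw [← degree_eq_natDegree hf0]
    exact degree_divByMonic_lt f _ hf0 (by simp)
  have hSf : ∀ w, S w * f.eval (b w) = Q.eval (b w) +
      ∑ i ∈ I, β i * f.eval (a i) / (a i - b w) +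
      ∑ j ∈ J, if w = Fin.castLE hrv j then γ j * f.eval (b (Fin.castLE hrv j)) else 0 := by
    intro w
    simp only [hS, hQ, Pi.add_apply, Finset.sum_apply, Pi.smul_apply, smul_eq_mul, hhvec, hgstd,
      add_mul, Finset.sum_mul, eval_neg, eval_finsetSum, eval_mul, eval_C]
    congr 1
    · rw [← Finset.sum_neg_distrib, ← Finset.sum_add_distrib]
      refine Finset.sum_congr rfl fun i _ => ?_
      linear_combination β i * eval_div_sub_eq f (hne i w)
    · refine Finset.sum_congr rfl fun j _ => ?_
      by_cases hw : w = Fin.castLE hrv j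
      · simp [hw]
      · simp [hw]
  constructor
  · rintro ⟨hI, hJ⟩
    refine ⟨Q, hQdeg, fun w => ?_⟩
    rw [hSf, Finset.sum_eq_zero fun i hi => by simp [hI i hi],
      Finset.sum_eq_zero fun j hj => by simp [hJ j hj], add_zero, add_zero]
  · rintro ⟨P, hPdeg, hP⟩
    have hcardI := Finset.card_sdiff_add_card_eq_card hEI
    have hcardJ := Finset.card_sdiff_add_card_eq_card hEJ
    have hPQdeg : (P - Q).degree < f.natDegree :=
      mem_degreeLT.1 (Submodule.sub_mem _ (mem_degreeLT.2 hPdeg) (mem_degreeLT.2 hQdeg))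
    obtain ⟨hPQ, hc⟩ := eq_zero_of_eval_eq_sum_cauchy hdist (I \ EI)
      ((J \ EJ).map (Fin.castLEEmb hrv)) (by rw [Finset.card_map, Fintype.card_fin]; omega)
      hPQdeg (fun i => β i * f.eval (a i)) (by
        intro w hw
        rw [eval_sub, hP, hSf, Finset.sum_eq_zero (s := J), ← Finset.sum_sdiff hEI,
          Finset.sum_eq_zero (s := EI) fun i hi => by simp [hEa i hi]]
        · ring
        intro j hj
        split_ifs with hwj
        · by_cases hjE : j ∈ EJ
          · rw [hEb j hjE, mul_zero]
          · exact absurd (Finset.mem_map.2 ⟨j, Finset.mem_sdiff.2 ⟨hj, hjE⟩, hwj.symm⟩) hw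
        · rfl)
    have hI : ∀ i ∈ I, f.eval (a i) = 0 := by
      intro i hi
      by_cases hiE : i ∈ EI
      · exact hEa i hiE
      · exact (mul_eq_zero.1 (hc i (Finset.mem_sdiff.2 ⟨hi, hiE⟩))).resolve_left (hβ i hi)
    refine ⟨hI, fun j hj => ?_⟩
    have h := hSf (Fin.castLE hrv j)
    rw [← hP, sub_eq_zero.1 hPQ, Finset.sum_eq_zero fun i hi => by simp [hI i hi], add_zero,
      left_eq_add, Finset.sum_eq_single_of_mem j hj, if_pos rfl] at h
    · exact (mul_eq_zero.1 h).resolve_left (hγ j hj)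
    · intro j' _ hj'
      exact if_neg fun he => hj' (Fin.castLE_injective hrv he).symm
end

section
/- Let F be a finite field, s ∈ ℕ, g ∈ F[X], and σ¹, σ² ∈ F^s. For σ = (σ_1,…,σ_s) ∈ F^s define f(X;σ) = g(X)·(X^s + σ_1X^{s−1} + σ_2X^{s−2} + ⋯ + σ_{s−1}X + σ_s), and for γ ∈ F set σ_γ = γ·σ¹ + (1−γ)·σ². Assume there exists γ* ∈ F such that f(X;σ_{γ*}) is separable. Then for every subset Y ⊆ F with |Y| ≥ 2(s + deg g) + 1, there exists γ ∈ Y such that f(X;σ_γ) is separable. -/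
open Polynomial

theorem Polynomial.sylvester_C_mul_add {R : Type*} [CommRing R] (c : R) (p q p' q' : R[X])
    (m n : ℕ) :
    sylvester (C c * p + q) (C c * p' + q') m n =
      c • sylvester p p' m n + sylvester q q' m n := by
  ext i j
  induction j using Fin.addCases <;>
    simp only [sylvester, Matrix.of_apply, Matrix.add_apply, Matrix.smul_apply,
      Fin.addCases_left, Fin.addCases_right, coeff_add, coeff_C_mul, smul_eq_mul] <;>
    split_ifs <;> simp

/-- The resultant along a pencil is a polynomial function of the parameter, of degree at most
the size of the Sylvester matrix. -/
theorem Polynomial.exists_eval_eq_resultant_pencil {R : Type*} [CommRing R] (p q p' q' : R[X])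
    (m n : ℕ) :
    ∃ D : R[X], D.natDegree ≤ m + n ∧
      ∀ c, D.eval c = resultant (C c * p + q) (C c * p' + q') m n := by
  refine ⟨_, (natDegree_det_X_add_C_le (sylvester p p' m n) (sylvester q q' m n)).trans_eq
    (Fintype.card_fin _), fun c => ?_⟩
  rw [resultant, sylvester_C_mul_add, ← coe_evalRingHom, RingHom.map_det]
  congr 1
  ext i j
  simp [mul_comm c]

theorem Polynomial.resultant_derivative_ne_zero_iff_separable {K : Type*} [Field K] {p : K[X]}
    (hp : p ≠ 0) :
    resultant p (derivative p) p.natDegree p.natDegree ≠ 0 ↔ p.Separable := by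
  obtain ⟨k, hk⟩ := Nat.exists_eq_add_of_le
    ((natDegree_derivative_le p).trans (Nat.sub_le _ _))
  conv_lhs => rw [show resultant p (derivative p) p.natDegree p.natDegree =
    resultant p (derivative p) p.natDegree ((derivative p).natDegree + k) by rw [← hk]]
  rw [resultant_add_right_deg _ _ _ _ _ le_rfl, coeff_natDegree, separable_def]
  simp [hp, resultant_eq_zero_iff]

theorem Polynomial.exists_separable_mem_of_pencil {K : Type*} [Field K] (p q : K[X]) (d : ℕ)
    (hd : ∀ c, (C c * p + q).natDegree = d) (hne : ∀ c, C c * p + q ≠ 0)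
    (hex : ∃ c, (C c * p + q).Separable) (Y : Finset K) (hY : 2 * d + 1 ≤ Y.card) :
    ∃ c ∈ Y, (C c * p + q).Separable := by
  obtain ⟨D, hD, hev⟩ := exists_eval_eq_resultant_pencil p q (derivative p) (derivative q) d d
  have key (c : K) : D.eval c ≠ 0 ↔ (C c * p + q).Separable := by
    rw [← resultant_derivative_ne_zero_iff_separable (hne c), hd, hev, derivative_add,
      derivative_C_mul]
  simp only [← key] at hex ⊢
  by_contra! h
  obtain ⟨c, hc⟩ := hex
  refine hc ?_
  rw [eq_zero_of_natDegree_lt_card_of_eval_eq_zero' D Y h (by omega), eval_zero]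

theorem Polynomial.degree_sum_C_mul_X_pow_rev_lt {R : Type*} [Semiring R] {s : ℕ}
    (a : Fin s → R) :
    (∑ m : Fin s, C (a m) * X ^ (s - 1 - (m : ℕ))).degree < (s : WithBot ℕ) := by
  refine (degree_sum_le _ _).trans_lt
    ((Finset.sup_lt_iff (WithBot.bot_lt_coe s)).2 fun m _ => ?_)
  exact (degree_C_mul_X_pow_le _ _).trans_lt (WithBot.coe_lt_coe.2 (by have := m.isLt; lia))

/-- for `f(X;σ) = g(X)·(Xˢ + σ₁X^{s−1} + ⋯ + σ_s)` and
`σ_γ = γ·σ¹ + (1−γ)·σ²`, if some `f(X;σ_{γ*})` is separable, then every subset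
`Y ⊆ F` with `|Y| ≥ 2(s + deg g) + 1` contains a `γ` with `f(X;σ_γ)` separable. -/
theorem exists_separable_in_pencil {F : Type} [Field F] [Fintype F]
    (s : ℕ) (g : Polynomial F) (σ1 σ2 : Fin s → F)
    (f : (Fin s → F) → Polynomial F)
    (hf : ∀ σ : Fin s → F,
      f σ = g * (X ^ s + ∑ m : Fin s, C (σ m) * X ^ (s - 1 - (m : ℕ))))
    (hex : ∃ γ : F, (f (γ • σ1 + (1 - γ) • σ2)).Separable) :
    ∀ Y : Finset F, 2 * (s + g.natDegree) + 1 ≤ Y.card →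
      ∃ γ ∈ Y, (f (γ • σ1 + (1 - γ) • σ2)).Separable := by
  have hg : g ≠ 0 := by
    rintro rfl
    obtain ⟨γ, hγ⟩ := hex
    exact hγ.ne_zero (by rw [hf, zero_mul])
  have hmonic (σ : Fin s → F) := monic_X_pow_add (degree_sum_C_mul_X_pow_rev_lt σ)
  have hne (σ : Fin s → F) : f σ ≠ 0 := by
    rw [hf]
    exact mul_ne_zero hg (hmonic σ).ne_zero
  have hdeg (σ : Fin s → F) : (f σ).natDegree = s + g.natDegree := by
    rw [hf, natDegree_mul hg (hmonic σ).ne_zero, add_comm, natDegree_add_eq_left_of_degree_lt,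
      natDegree_X_pow]
    simpa using degree_sum_C_mul_X_pow_rev_lt σ
  have hpencil (γ : F) : f (γ • σ1 + (1 - γ) • σ2) = C γ * (f σ1 - f σ2) + f σ2 := by
    simp only [hf, Pi.add_apply, Pi.smul_apply, smul_eq_mul, map_add, map_mul, map_sub, map_one,
      add_mul, mul_assoc, Finset.sum_add_distrib, ← Finset.mul_sum]
    ring
  simp only [hpencil] at hex ⊢
  exact exists_separable_mem_of_pencil _ _ _ (fun γ => by rw [← hpencil, hdeg])
    (fun γ => by rw [← hpencil]; exact hne _) hex
end

section
/- Let F be a field, let l ≥ 1, and let X_1,…,X_{l−1}, b_1,…,b_l ∈ F be such that all 2l−1 of these elements are pairwise distinct. Let S = (S_1,…,S_l) ∈ F^l, and let M ∈ F^{l×l} be the matrix whose i-th row, for 1 ≤ i ≤ l−1, is (1/(X_i − b_1),…,1/(X_i − b_l)), and whose l-th row is S. Then det(M) = 0 if and only if Σ_{z=1}^{l} S_z · ∏_{i=1}^{l−1}(b_z − X_i) / ∏_{j≠z}(b_z − b_j) = 0. -/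
open Polynomial Lagrange in
/-- The vectors orthogonal to all rows `(1/(Xᵢ − b₁),…,1/(Xᵢ − b_l))` of a Cauchy matrix with one
row fewer than columns are the multiples of the vector with entries
`nodalWeight * ∏ (b_z - X_i)`. -/
theorem cauchy_ker_iff {F : Type*} [Field F] {n : ℕ} {x : Fin n → F} {b : Fin (n + 1) → F}
    (hx : Function.Injective x) (hb : Function.Injective b) (hxb : ∀ i j, x i ≠ b j)
    (v : Fin (n + 1) → F) :
    (∀ i, ∑ z, (x i - b z)⁻¹ * v z = 0) ↔
      ∃ c, ∀ z, v z = c * (nodalWeight Finset.univ b z * ∏ i, (b z - x i)) := by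
  have hw (z) : nodalWeight Finset.univ b z ≠ 0 :=
    nodalWeight_ne_zero hb.injOn (Finset.mem_univ z)
  have eval_x (r : Fin (n + 1) → F) (i : Fin n) :
      eval (x i) (interpolate Finset.univ b r) = 0 ↔
        ∑ z, (x i - b z)⁻¹ * (nodalWeight Finset.univ b z * r z) = 0 := by
    rw [eval_interpolate_not_at_node r fun j _ => hxb i j, mul_eq_zero,
      or_iff_right (eval_nodal_not_at_node fun j _ => hxb i j)]
    exact Eq.congr_left (Finset.sum_congr rfl fun z _ => by ring)
  have hN : (nodal Finset.univ x).natDegree = n := by simp [natDegree_nodal]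
  constructor
  · intro h
    set P := interpolate Finset.univ b fun z => (nodalWeight Finset.univ b z)⁻¹ * v z with hP
    have hdeg : P.degree < (n + 1 : ℕ) := by
      simpa only [Finset.card_univ, Fintype.card_fin] using
        degree_interpolate_lt (s := Finset.univ)
          (fun z => (nodalWeight Finset.univ b z)⁻¹ * v z) hb.injOn
    have hPN : P = C (P.coeff n) * nodal Finset.univ x := by
      refine sub_eq_zero.mp
        (eq_zero_of_degree_lt_of_eval_index_eq_zero Finset.univ hx.injOn ?_ ?_)
      · rw [Finset.card_univ, Fintype.card_fin, degree_lt_iff_coeff_zero]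
        intro m hm
        rcases hm.eq_or_lt with rfl | hm
        · have : (nodal Finset.univ x).coeff n = 1 := by
            simpa [Monic, leadingCoeff, hN] using nodal_monic (s := Finset.univ) (v := x)
          simp [this]
        · rw [coeff_sub, coeff_C_mul, (degree_lt_iff_coeff_zero _ _).mp hdeg m hm,
            coeff_eq_zero_of_natDegree_lt (hN.trans_lt hm), mul_zero, sub_zero]
      · intro i hi
        rw [eval_sub, eval_mul, eval_nodal_at_node hi, mul_zero, sub_zero, hP, eval_x]
        simpa [mul_inv_cancel_left₀ (hw _)] using h i
    refine ⟨P.coeff n, fun z => ?_⟩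
    have hz : eval (b z) P = (nodalWeight Finset.univ b z)⁻¹ * v z :=
      eval_interpolate_at_node _ hb.injOn (Finset.mem_univ z)
    rw [hPN, eval_mul, eval_C, eval_nodal, eq_inv_mul_iff_mul_eq₀ (hw z)] at hz
    rw [← hz]
    ring
  · rintro ⟨c, hc⟩ i
    have hdeg : (nodal Finset.univ x).degree < (Finset.univ : Finset (Fin (n + 1))).card := by
      rw [degree_nodal]
      simp only [Finset.card_univ, Fintype.card_fin]
      exact_mod_cast n.lt_succ_self
    have h := eval_nodal_at_node (v := x) (Finset.mem_univ i)
    rw [eq_interpolate hb.injOn hdeg, eval_x] at h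
    simp only [eval_nodal] at h
    simp_rw [hc, mul_left_comm _ c, ← Finset.mul_sum, h, mul_zero]


/-- with `l = n + 1 ≥ 1`: let `X₁,…,X_{l−1}, b₁,…,b_l` be pairwise
distinct, let `M` have rows `(1/(Xᵢ − b₁),…,1/(Xᵢ − b_l))` for `i < l` and last row `S`.
Then `det M = 0` iff `Σ_z S_z·∏_{i}(b_z − X_i)/∏_{j≠z}(b_z − b_j) = 0`. -/
theorem bordered_cauchy_det_eq_zero_iff {F : Type} [Field F] (n : ℕ)
    (Xv : Fin n → F) (b : Fin (n + 1) → F)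
    (hdist : Function.Injective (Sum.elim Xv b))
    (S : Fin (n + 1) → F)
    (M : Matrix (Fin (n + 1)) (Fin (n + 1)) F)
    (hM : ∀ i j, M i j = if h : (i : ℕ) < n then (Xv ⟨i, h⟩ - b j)⁻¹ else S j) :
    M.det = 0 ↔
      ∑ z : Fin (n + 1),
        S z * (∏ i : Fin n, (b z - Xv i)) / ∏ j ∈ Finset.univ.erase z, (b z - b j) = 0 := by
  have hx : Function.Injective Xv := hdist.comp Sum.inl_injective
  have hb : Function.Injective b := hdist.comp Sum.inr_injective
  have hxb (i j) : Xv i ≠ b j := hdist.ne Sum.inl_ne_inr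
  have hker := cauchy_ker_iff hx hb hxb
  set w : Fin (n + 1) → F := fun z =>
    Lagrange.nodalWeight Finset.univ b z * ∏ i, (b z - Xv i) with hw
  have hsum : ∑ z, S z * (∏ i, (b z - Xv i)) / ∏ j ∈ Finset.univ.erase z, (b z - b j) =
      ∑ z, S z * w z := by
    refine Finset.sum_congr rfl fun z _ => ?_
    simp only [hw, Lagrange.nodalWeight, Finset.prod_inv_distrib, div_eq_mul_inv]
    ring
  have hmul (v : Fin (n + 1) → F) : M.mulVec v = 0 ↔
      (∀ i, ∑ z, (Xv i - b z)⁻¹ * v z = 0) ∧ ∑ z, S z * v z = 0 := by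
    simp [funext_iff, Fin.forall_fin_succ', Matrix.mulVec, dotProduct, hM]
  rw [hsum, ← Matrix.exists_mulVec_eq_zero_iff]
  constructor
  · rintro ⟨v, hv0, hv⟩
    obtain ⟨hrows, hS⟩ := (hmul v).mp hv
    obtain ⟨c, hc⟩ := (hker v).mp hrows
    have hc0 : c ≠ 0 := by
      rintro rfl
      exact hv0 (funext fun z => by simp [hc])
    simp_rw [hc, mul_left_comm _ c, ← Finset.mul_sum] at hS
    exact (mul_eq_zero.mp hS).resolve_left hc0
  · intro hS
    refine ⟨w, fun h0 => ?_, (hmul w).mpr ⟨(hker w).mpr ⟨1, fun z => (one_mul _).symm⟩, hS⟩⟩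
    refine mul_ne_zero (Lagrange.nodalWeight_ne_zero hb.injOn (Finset.mem_univ 0))
      (Finset.prod_ne_zero_iff.mpr fun i _ => sub_ne_zero.mpr (hxb i 0).symm) (congrFun h0 0)
end

section
/- Assume the hierarchical construction. Fix i ∈ {1,…,p}, let m = (m_1,…,m_p) be a message with local codewords c_j = (m_j, s_j), and let c'_i = (m'_i, s'_i) ∈ F^{k_i+r_i} be arbitrary. Let H_i^G = [A_{i,i}, (B_{i,j})_{j≠i}; −I_{r_i}, 0]ᵀ be the global parity-check matrix, whose transpose is the (k_i+r_i)×(r_i + Σ_{j≠i} δ_j) matrix with top blocks A_{i,i} and B_{i,j} (j ≠ i, in order) and bottom blocks −I_{r_i} and 0. Then the syndrome H_i^G·(c'_i − c_i)ᵀ equals the concatenation of S_i = m'_i·A_{i,i} − s'_i + Σ_{j≠i} m_j·A_{j,i} with the vectors S_{i,j} = (m'_i − m_i)·B_{i,j} for j ≠ i; moreover, for each j ≠ i, S_{i,j}·U_j = m_j·A_{j,j} − s_j + m'_i·A_{i,j} + Σ_{l≠i,j} m_l·A_{l,j}, so each S_{i,j}·U_j is computable from c'_i and the codewords c_l with l ≠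 i. -/
/-- in the hierarchical construction, the global syndrome
`H_i^G·(c'_i − c_i)ᵀ` equals the concatenation of
`S_i = m'_i·A_{i,i} − s'_i + Σ_{j≠i} m_j·A_{j,i}` with the vectors
`S_{i,j} = (m'_i − m_i)·B_{i,j}` for `j ≠ i`; moreover for each `j ≠ i`,
`S_{i,j}·U_j = m_j·A_{j,j} − s_j + m'_i·A_{i,j} + Σ_{l≠i,j} m_l·A_{l,j}`. -/
theorem global_syndrome_decomposition {F : Type} [Field F] (p : ℕ) (hp : 1 ≤ p)
    (k r δ : Fin p → ℕ)
    (hk : ∀ i, 0 < k i) (hδpos : ∀ i, 0 < δ i) (hrδ : ∀ i, δ i < r i)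
    (A : ∀ i j : Fin p, Matrix (Fin (k i)) (Fin (r j)) F)
    (B : ∀ i j : Fin p, Matrix (Fin (k i)) (Fin (δ j)) F)
    (U : ∀ i : Fin p, Matrix (Fin (δ i)) (Fin (r i)) F)
    (hAB : ∀ i j : Fin p, i ≠ j → A i j = B i j * U j)
    (m : ∀ i : Fin p, Fin (k i) → F)
    (s : ∀ j : Fin p, Fin (r j) → F)
    (hs : ∀ j : Fin p, s j = Matrix.vecMul (m j) (A j j) +
      ∑ l ∈ Finset.univ.erase j, Matrix.vecMul (m l) (A l j))
    (i : Fin p)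
    (m' : Fin (k i) → F) (s' : Fin (r i) → F)
    (HGT : Matrix (Fin (k i) ⊕ Fin (r i))
      (Fin (r i) ⊕ Σ j : {j : Fin p // j ≠ i}, Fin (δ j.1)) F)
    (hHGT : HGT = Matrix.fromBlocks (A i i)
      (Matrix.of fun x jc => B i jc.1.1 x jc.2) (-1) 0)
    (SI : Fin (r i) → F)
    (hSI : SI = Matrix.vecMul m' (A i i) - s' +
      ∑ j ∈ Finset.univ.erase i, Matrix.vecMul (m j) (A j i))
    (SIJ : ∀ j : Fin p, Fin (δ j) → F)
    (hSIJ : ∀ j : Fin p, SIJ j = Matrix.vecMul (m' - m i) (B i j)) :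
    Matrix.vecMul (Sum.elim (m' - m i) (s' - s i)) HGT =
      Sum.elim SI (fun jc => SIJ jc.1.1 jc.2) ∧
    ∀ j : Fin p, j ≠ i → Matrix.vecMul (SIJ j) (U j) =
      Matrix.vecMul (m j) (A j j) - s j + Matrix.vecMul m' (A i j) +
        ∑ l ∈ (Finset.univ.erase i).erase j, Matrix.vecMul (m l) (A l j) := by
  subst hHGT hSI
  refine ⟨?_, fun j hj => ?_⟩
  · rw [Matrix.vecMul_fromBlocks]
    congr 1
    · rw [hs i]
      simp only [Sum.elim_comp_inl, Sum.elim_comp_inr, Matrix.sub_vecMul, Matrix.vecMul_neg,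
        Matrix.vecMul_one]
      abel
    · funext jc
      simp [hSIJ, Matrix.vecMul, dotProduct]
  · have hi : i ∈ Finset.univ.erase j := Finset.mem_erase.2 ⟨hj.symm, Finset.mem_univ i⟩
    rw [hSIJ, Matrix.vecMul_vecMul, ← hAB i j hj.symm, hs j, ← Finset.add_sum_erase _ _ hi,
      Finset.erase_right_comm, Matrix.sub_vecMul]
    abel
end
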